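/- Let k ≥ 5 be an integer and let α be a real number with 2/k < α < 1. Suppose there is a real polynomial Q of degree k − 1 such that for every ε > 0 one has Σ_{n ≤ x} τ_k(n) = x·Q(log x) + O(x^{α + ε}) for x > 5. Then there exists a real polynomial P of degree k − 1 such that for every ε > 0, S_{μ,k}(x) = x·P(log x) + O(x^{α + ε}) for x > 5. -/

import Mathlib

open Finset

/-- The set of ordered `k`-tuples of positive integers whose product is `n`. -/
def piltzTuples (k n : ℕ) : Finset (Fin k → ℕ) :=
  (Fintype.piFinset fun _ => n.divisors).filter fun d => ∏ i, d i = n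

/-- The Piltz divisor function `τ_k(n)`: the number of ordered `k`-tuples of positive
integers with product `n`. -/
def piltzTau (k n : ℕ) : ℕ := (piltzTuples k n).card

/-- `f_{(g,k)}(n) = ∑_{d₁⋯d_k = n} g(gcd(d₁,…,d_k))`. -/
noncomputable def fgk (g : ℕ → ℝ) (k n : ℕ) : ℝ :=
  ∑ d ∈ piltzTuples k n, g (Finset.univ.gcd d)

/-- `S_{g,k}(x) = ∑_{n ≤ x} f_{(g,k)}(n)`. -/
noncomputable def Sgk (g : ℕ → ℝ) (k : ℕ) (x : ℝ) : ℝ :=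
  ∑ n ∈ Finset.Icc 1 ⌊x⌋₊, fgk g k n

theorem mem_piltzTuples {k n : ℕ} (hn : n ≠ 0) (d : Fin k → ℕ) :
    d ∈ piltzTuples k n ↔ ∏ i, d i = n := by
  simp only [piltzTuples, Finset.mem_filter, Fintype.mem_piFinset, Nat.mem_divisors,
    and_iff_right_iff_imp]
  rintro rfl i
  exact ⟨Finset.dvd_prod_of_mem d (Finset.mem_univ i), hn⟩

/-- Tuples all of whose entries are divisible by `m` are dilations by `m`. -/
theorem card_piltzTuples_filter_dvd {k n m : ℕ} (hn : n ≠ 0) (hm : m ≠ 0) :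
    ((piltzTuples k n).filter fun d => ∀ i, m ∣ d i).card =
      if m ^ k ∣ n then piltzTau k (n / m ^ k) else 0 := by
  have hmk : 0 < m ^ k := pow_pos (Nat.pos_of_ne_zero hm) k
  split_ifs with h
  · obtain ⟨q, rfl⟩ := h
    have hq : q ≠ 0 := right_ne_zero_of_mul hn
    rw [Nat.mul_div_cancel_left q hmk, piltzTau]
    symm
    refine Finset.card_bij (fun d _ i => m * d i) ?_ ?_ ?_
    · intro d hd
      rw [mem_piltzTuples hq] at hd
      rw [Finset.mem_filter, mem_piltzTuples hn]
      exact ⟨by simp [Finset.prod_mul_distrib, hd], fun i => dvd_mul_right _ _⟩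
    · intro d _ e _ hde
      funext i
      exact Nat.eq_of_mul_eq_mul_left (Nat.pos_of_ne_zero hm) (congrFun hde i)
    · intro d hd
      rw [Finset.mem_filter, mem_piltzTuples hn] at hd
      choose e he using hd.2
      refine ⟨e, ?_, (funext he).symm⟩
      rw [mem_piltzTuples hq]
      have h1 := hd.1
      simp only [he, Finset.prod_mul_distrib, Finset.prod_const, Finset.card_univ,
        Fintype.card_fin] at h1
      exact Nat.eq_of_mul_eq_mul_left hmk h1
  · rw [Finset.card_eq_zero, Finset.filter_eq_empty_iff]
    intro d hd hdvd
    rw [mem_piltzTuples hn] at hd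
    apply h
    have := Finset.prod_dvd_prod_of_dvd (fun _ : Fin k => m) d (s := Finset.univ)
      (fun i _ => hdvd i)
    simpa [hd] using this

/-- Summation over the multiples of `M` up to `N`. -/
theorem sum_Icc_ite_dvd (F : ℕ → ℝ) (N : ℕ) {M : ℕ} (hM : 0 < M) :
    (∑ n ∈ Finset.Icc 1 N, if M ∣ n then F (n / M) else 0) =
      ∑ j ∈ Finset.Icc 1 (N / M), F j := by
  rw [← Finset.sum_filter]
  symm
  refine Finset.sum_bij (fun j _ => M * j) ?_ ?_ ?_ ?_
  · intro j hj
    simp only [Finset.mem_filter, Finset.mem_Icc] at hj ⊢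
    refine ⟨⟨Nat.mul_pos hM hj.1, ?_⟩, dvd_mul_right _ _⟩
    rw [mul_comm]
    exact (Nat.le_div_iff_mul_le hM).1 hj.2
  · intro a _ b _ hab
    exact Nat.eq_of_mul_eq_mul_left hM hab
  · intro n hn
    simp only [Finset.mem_filter, Finset.mem_Icc] at hn
    obtain ⟨⟨h1, h2⟩, q, rfl⟩ := hn
    refine ⟨q, ?_, rfl⟩
    rw [Finset.mem_Icc]
    exact ⟨Nat.pos_of_ne_zero (by rintro rfl; simp at h1),
      (Nat.le_div_iff_mul_le hM).2 (by rwa [mul_comm])⟩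
  · intro j _
    rw [Nat.mul_div_cancel_left j hM]

/-- If `g = h * 1`, then `f_{(g,k)}(n) = ∑_{m^k ∣ n} h(m) τ_k(n / m^k)`. -/
theorem fgk_eq_sum {g h : ℕ → ℝ} (hg : ∀ e ≠ 0, g e = ∑ m ∈ e.divisors, h m) {k n N : ℕ}
    (hk : k ≠ 0) (hn : n ≠ 0) (hnN : n ≤ N) :
    fgk g k n = ∑ m ∈ Finset.Icc 1 N,
      h m * (if m ^ k ∣ n then (piltzTau k (n / m ^ k) : ℝ) else 0) := by
  have key : ∀ d ∈ piltzTuples k n, g (Finset.univ.gcd d) =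
      ∑ m ∈ Finset.Icc 1 N, if ∀ i, m ∣ d i then h m else 0 := by
    intro d hd
    rw [mem_piltzTuples hn] at hd
    have i₀ : Fin k := ⟨0, Nat.pos_of_ne_zero hk⟩
    have hdvd : Finset.univ.gcd d ∣ n :=
      (Finset.gcd_dvd (Finset.mem_univ i₀)).trans
        (hd ▸ Finset.dvd_prod_of_mem d (Finset.mem_univ i₀))
    have hne : Finset.univ.gcd d ≠ 0 := ne_zero_of_dvd_ne_zero hn hdvd
    rw [hg _ hne, ← Finset.sum_filter]
    refine Finset.sum_congr ?_ fun _ _ => rfl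
    ext m
    simp only [Nat.mem_divisors, Finset.mem_filter, Finset.mem_Icc, Finset.dvd_gcd_iff,
      Finset.mem_univ, true_implies]
    constructor
    · rintro ⟨h1, _⟩
      have h2 : m ∣ n := (Finset.dvd_gcd fun i _ => h1 i).trans hdvd
      exact ⟨⟨Nat.pos_of_dvd_of_pos h2 (Nat.pos_of_ne_zero hn),
        (Nat.le_of_dvd (Nat.pos_of_ne_zero hn) h2).trans hnN⟩, h1⟩
    · exact fun h1 => ⟨h1.2, hne⟩
  rw [fgk, Finset.sum_congr rfl key, Finset.sum_comm]
  refine Finset.sum_congr rfl fun m hm => ?_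
  have hm0 : m ≠ 0 := Nat.one_le_iff_ne_zero.1 (Finset.mem_Icc.1 hm).1
  rw [← Finset.sum_filter, Finset.sum_const, card_piltzTuples_filter_dvd hn hm0, nsmul_eq_mul,
    mul_comm]
  push_cast
  rfl

/-- If `g = h * 1`, then `S_{g,k}(x)` is the sum of `h(m) T(x / m^k)` over `m ≥ 1`, with `T` the
summatory function of `τ_k`. -/
theorem hasSum_Sgk {g h : ℕ → ℝ} (hg : ∀ e ≠ 0, g e = ∑ m ∈ e.divisors, h m) (h0 : h 0 = 0)
    {k : ℕ} (hk : k ≠ 0) (x : ℝ) :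
    HasSum (fun m : ℕ => h m *
      ∑ n ∈ Finset.Icc 1 ⌊x / (m : ℝ) ^ k⌋₊, (piltzTau k n : ℝ)) (Sgk g k x) := by
  have hfl : ∀ m : ℕ, ⌊x / (m : ℝ) ^ k⌋₊ = ⌊x⌋₊ / m ^ k := by
    intro m
    rw [← Nat.cast_pow, Nat.floor_div_natCast]
  have hS : Sgk g k x = ∑ m ∈ Finset.Icc 1 ⌊x⌋₊, h m *
      ∑ n ∈ Finset.Icc 1 ⌊x / (m : ℝ) ^ k⌋₊, (piltzTau k n : ℝ) := by
    rw [Sgk, Finset.sum_congr rfl fun n hn => fgk_eq_sum hg hk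
      (Nat.one_le_iff_ne_zero.1 (Finset.mem_Icc.1 hn).1) (Finset.mem_Icc.1 hn).2,
      Finset.sum_comm]
    refine Finset.sum_congr rfl fun m hm => ?_
    rw [← Finset.mul_sum, hfl,
      sum_Icc_ite_dvd (fun n => (piltzTau k n : ℝ)) _ (pow_pos (Finset.mem_Icc.1 hm).1 k)]
  rw [hS]
  apply hasSum_sum_of_ne_finset_zero
  intro m hm
  rcases Nat.eq_zero_or_pos m with rfl | hpos
  · simp [h0]
  · have hlt : ⌊x⌋₊ < m := by
      by_contra hcon
      exact hm (Finset.mem_Icc.2 ⟨hpos, not_lt.1 hcon⟩)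
    rw [hfl, Nat.div_eq_of_lt (hlt.trans_le (Nat.le_self_pow hk m))]
    simp

theorem exists_abs_eval_le_mul_exp (Q : Polynomial ℝ) {δ : ℝ} (hδ : 0 < δ) :
    ∃ C : ℝ, 0 ≤ C ∧ ∀ u : ℝ, |Q.eval u| ≤ C * Real.exp (δ * |u|) := by
  induction Q using Polynomial.induction_on' with
  | add p q hp hq =>
    obtain ⟨C, hC, h1⟩ := hp
    obtain ⟨D, hD, h2⟩ := hq
    refine ⟨C + D, by positivity, fun u => ?_⟩
    rw [Polynomial.eval_add, add_mul]
    exact (abs_add_le _ _).trans (add_le_add (h1 u) (h2 u))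
  | monomial n a =>
    refine ⟨|a| * (n.factorial / δ ^ n), by positivity, fun u => ?_⟩
    have h := Real.pow_div_factorial_le_exp (δ * |u|) (by positivity) n
    rw [div_le_iff₀ (by positivity), mul_pow] at h
    rw [Polynomial.eval_monomial, abs_mul, abs_pow, mul_assoc]
    refine mul_le_mul_of_nonneg_left ?_ (abs_nonneg a)
    rw [div_mul_eq_mul_div, le_div_iff₀ (by positivity)]
    linarith

/-- An asymptotic error bound for `y > 5` with exponent `β < 1` extends to all `y > 0`, the
summatory function vanishing on `(0, 1)`. -/
theorem exists_error_bound_of_pos (F : ℕ → ℝ) (Q : Polynomial ℝ) {β : ℝ} (hβ₀ : 0 ≤ β)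
    (hβ : β < 1)
    (H : ∃ C : ℝ, 0 < C ∧ ∀ x : ℝ, 5 < x →
      |(∑ n ∈ Finset.Icc 1 ⌊x⌋₊, F n) - x * Q.eval (Real.log x)| ≤ C * x ^ β) :
    ∃ C : ℝ, 0 < C ∧ ∀ x : ℝ, 0 < x →
      |(∑ n ∈ Finset.Icc 1 ⌊x⌋₊, F n) - x * Q.eval (Real.log x)| ≤ C * x ^ β := by
  obtain ⟨C, hC, hCx⟩ := H
  obtain ⟨D, hD, hDu⟩ := exists_abs_eval_le_mul_exp Q (sub_pos.2 hβ)
  set A : ℝ := ∑ n ∈ Finset.Icc 1 5, |F n| with hA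
  have hA0 : 0 ≤ A := Finset.sum_nonneg fun _ _ => abs_nonneg _
  set B : ℝ := 5 * (D * Real.exp ((1 - β) * Real.log 5)) with hB
  have hB0 : 0 ≤ B := by positivity
  refine ⟨C + D + A + B, by positivity, fun x hx => ?_⟩
  have hxβ : 0 < x ^ β := Real.rpow_pos_of_pos hx β
  have mono : ∀ c, c ≤ C + D + A + B → c * x ^ β ≤ (C + D + A + B) * x ^ β :=
    fun c hc => mul_le_mul_of_nonneg_right hc hxβ.le
  rcases lt_or_ge 5 x with h5 | h5
  · exact (hCx x h5).trans (mono _ (by linarith))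
  rcases lt_or_ge x 1 with h1 | h1
  · refine le_trans ?_ (mono D (by linarith))
    rw [Nat.floor_eq_zero.2 h1]
    have hlog : |Real.log x| = -Real.log x := abs_of_neg (Real.log_neg hx h1)
    have hb := hDu (Real.log x)
    have hexp : x * Real.exp ((1 - β) * -Real.log x) = x ^ β := by
      conv_lhs => rw [← Real.exp_log hx, Real.log_exp]
      rw [← Real.exp_add, Real.rpow_def_of_pos hx]
      congr 1
      ring
    rw [hlog] at hb
    simp only [zero_lt_one, Finset.Icc_eq_empty_of_lt, Finset.sum_empty, zero_sub, abs_neg,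
      abs_mul, abs_of_pos hx]
    calc x * |Q.eval (Real.log x)| ≤ x * (D * Real.exp ((1 - β) * -Real.log x)) := by gcongr
      _ = D * x ^ β := by rw [← hexp]; ring
  · have hfl : ⌊x⌋₊ ≤ 5 := Nat.floor_le_of_le (by exact_mod_cast h5)
    have e1 : |∑ n ∈ Finset.Icc 1 ⌊x⌋₊, F n| ≤ A :=
      (Finset.abs_sum_le_sum_abs _ _).trans
        (Finset.sum_le_sum_of_subset_of_nonneg (Finset.Icc_subset_Icc_right hfl)
          fun _ _ _ => abs_nonneg _)
    have e2 : |x * Q.eval (Real.log x)| ≤ B := by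
      rw [abs_mul, abs_of_pos hx]
      have hl0 : 0 ≤ Real.log x := Real.log_nonneg h1
      have hb := hDu (Real.log x)
      rw [abs_of_nonneg hl0] at hb
      have hl5 : Real.log x ≤ Real.log 5 := Real.log_le_log hx h5
      have h1β : 0 ≤ 1 - β := by linarith
      calc x * |Q.eval (Real.log x)| ≤ 5 * (D * Real.exp ((1 - β) * Real.log x)) := by gcongr
        _ ≤ B := by rw [hB]; gcongr
    have e3 : 1 ≤ x ^ β := Real.one_le_rpow h1 hβ₀
    calc _ ≤ A + B := (abs_sub _ _).trans (add_le_add e1 e2)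
      _ ≤ (A + B) * x ^ β := le_mul_of_one_le_right (by positivity) e3
      _ ≤ _ := mono _ (by linarith)

/-- For `|h(m)| ≤ m`, convolving `x Q(log x)` with `h` along `k`-th powers gives `x P(log x)`. -/
theorem exists_polynomial_hasSum {h : ℕ → ℝ} (hh : ∀ m, |h m| ≤ m) (h1 : h 1 = 1) {k : ℕ}
    (hk : 5 ≤ k) {Q : Polynomial ℝ} (hQ : Q.natDegree = k - 1) :
    ∃ P : Polynomial ℝ, P.natDegree = k - 1 ∧ ∀ L : ℝ,
      HasSum (fun m : ℕ => h m / (m : ℝ) ^ k * Q.eval (L - k * Real.log m)) (P.eval L) := by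
  have h0 : h 0 = 0 := by simpa using hh 0
  have hk0 : (0 : ℝ) < k := by positivity
  have bound : ∀ m : ℕ, |h m / (m : ℝ) ^ k| ≤ 1 / (m : ℝ) ^ 4 := by
    intro m
    rcases Nat.eq_zero_or_pos m with rfl | hm
    · simp [h0]
    have hm1 : (1 : ℝ) ≤ m := by exact_mod_cast hm
    rw [abs_div, abs_of_nonneg (by positivity : (0 : ℝ) ≤ (m : ℝ) ^ k),
      div_le_div_iff₀ (by positivity) (by positivity)]
    calc |h m| * (m : ℝ) ^ 4 ≤ m * (m : ℝ) ^ 4 := by gcongr; exact hh m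
      _ = (m : ℝ) ^ 5 := by ring
      _ ≤ 1 * (m : ℝ) ^ k := by rw [one_mul]; exact pow_le_pow_right₀ hm1 hk
  have h4 := hasSum_zeta_four
  have hsum0 : Summable fun m : ℕ => h m / (m : ℝ) ^ k :=
    Summable.of_norm_bounded h4.summable bound
  have hne : (∑' m : ℕ, h m / (m : ℝ) ^ k) ≠ 0 := by
    have e1 : HasSum (fun m : ℕ => h m / (m : ℝ) ^ k - if m = 1 then 1 else 0)
        ((∑' m : ℕ, h m / (m : ℝ) ^ k) - 1) := hsum0.hasSum.sub (hasSum_ite_eq 1 1)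
    have e2 : HasSum (fun m : ℕ => 1 / (m : ℝ) ^ 4 - if m = 1 then 1 else 0)
        (Real.pi ^ 4 / 90 - 1) := h4.sub (hasSum_ite_eq 1 1)
    have e3 := tsum_of_norm_bounded e2 (f := fun m : ℕ => h m / (m : ℝ) ^ k -
      if m = 1 then 1 else 0) (by
        intro m
        by_cases hm : m = 1
        · simp [hm, h1]
        · simpa only [hm, if_false, sub_zero, Real.norm_eq_abs] using bound m)
    rw [e1.tsum_eq] at e3
    intro hzero
    rw [hzero] at e3
    norm_num at e3
    have hpi : Real.pi ^ 4 < 3.15 ^ 4 :=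
      pow_lt_pow_left₀ Real.pi_lt_d2 Real.pi_pos.le (by norm_num)
    norm_num at hpi
    linarith
  set a : ℕ → ℕ → ℝ := fun i m =>
    h m / (m : ℝ) ^ k * (Polynomial.taylor (-(k * Real.log m)) Q).coeff i with ha
  have hsum : ∀ i, Summable (a i) := by
    intro i
    obtain ⟨C, hC, hCu⟩ :=
      exists_abs_eval_le_mul_exp (Polynomial.hasseDeriv i Q) (δ := 1 / k) (by positivity)
    have h3 : Summable fun m : ℕ => C * (1 / (m : ℝ) ^ 3) :=
      (Real.summable_one_div_nat_pow.2 (by norm_num)).mul_left C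
    refine Summable.of_norm_bounded h3 fun m => ?_
    rcases Nat.eq_zero_or_pos m with rfl | hm
    · simp [ha, h0]
    have hm1 : (1 : ℝ) ≤ m := by exact_mod_cast hm
    have hm0 : (0 : ℝ) < m := by positivity
    have hl : 0 ≤ Real.log m := Real.log_nonneg hm1
    have hc := hCu (-(k * Real.log m))
    rw [abs_neg, abs_of_nonneg (mul_nonneg hk0.le hl), ← mul_assoc, one_div_mul_cancel hk0.ne', one_mul,
      Real.exp_log hm0] at hc
    simp only [ha, Polynomial.taylor_coeff, Real.norm_eq_abs]
    rw [abs_mul]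
    calc _ ≤ 1 / (m : ℝ) ^ 4 * (C * m) := by gcongr; exact bound m
      _ = C * (1 / (m : ℝ) ^ 3) := by field_simp
  have hcoeff : ∀ j, (∑ i ∈ Finset.range k, Polynomial.monomial i (∑' m, a i m)).coeff j =
      if j < k then ∑' m, a j m else 0 := by
    intro j
    simp [Polynomial.coeff_monomial]
  refine ⟨∑ i ∈ Finset.range k, Polynomial.monomial i (∑' m, a i m), ?_, fun L => ?_⟩
  · apply Polynomial.natDegree_eq_of_le_of_coeff_ne_zero
    · rw [Polynomial.natDegree_le_iff_coeff_eq_zero]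
      intro j hj
      rw [hcoeff, if_neg (by omega)]
    · rw [hcoeff, if_pos (by omega)]
      have hlead : ∀ m, a (k - 1) m = h m / (m : ℝ) ^ k * Q.leadingCoeff := by
        intro m
        rw [ha, ← hQ]
        simp only [Polynomial.coeff_taylor_natDegree]
      simp only [hlead, tsum_mul_right]
      refine mul_ne_zero hne (Polynomial.leadingCoeff_ne_zero.2 ?_)
      rintro rfl
      rw [Polynomial.natDegree_zero] at hQ
      omega
  · simp only [Polynomial.eval_finsetSum, Polynomial.eval_monomial]
    have hs : HasSum (fun m => ∑ i ∈ Finset.range k, a i m * L ^ i)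
        (∑ i ∈ Finset.range k, (∑' m, a i m) * L ^ i) :=
      hasSum_sum fun i _ => (hsum i).hasSum.mul_right _
    refine hs.congr_fun ?_
    intro m
    have e : Q.eval (L - k * Real.log m) =
        (Polynomial.taylor (-(k * Real.log m)) Q).eval L := by
      rw [Polynomial.taylor_eval, sub_eq_add_neg]
    rw [e, Polynomial.eval_eq_sum_range' (n := k) (by rw [Polynomial.natDegree_taylor]; omega),
      Finset.mul_sum]
    refine Finset.sum_congr rfl fun i _ => ?_
    rw [ha, mul_assoc]

open ArithmeticFunction in
theorem moebius_eq_sum_moebius_mul_moebius (e : ℕ) :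
    ((moebius e : ℤ) : ℝ) = ∑ m ∈ e.divisors, (((moebius * moebius) m : ℤ) : ℝ) := by
  have h : ((moebius * moebius) * (zeta : ArithmeticFunction ℤ)) e = moebius e := by
    rw [mul_assoc, moebius_mul_coe_zeta, mul_one]
  rw [← h, coe_mul_zeta_apply]
  push_cast
  rfl

open ArithmeticFunction in
theorem abs_moebius_mul_moebius_le (m : ℕ) :
    |(((moebius * moebius) m : ℤ) : ℝ)| ≤ m := by
  rw [← Int.cast_abs]
  have h : |(moebius * moebius) m| ≤ (m : ℤ) := by
    rw [mul_apply]
    calc _ ≤ ∑ p ∈ m.divisorsAntidiagonal, |moebius p.1 * moebius p.2| :=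
          Finset.abs_sum_le_sum_abs _ _
      _ ≤ ∑ p ∈ m.divisorsAntidiagonal, (1 : ℤ) := by
          refine Finset.sum_le_sum fun p _ => ?_
          rw [abs_mul]
          exact mul_le_one₀ abs_moebius_le_one (abs_nonneg _) abs_moebius_le_one
      _ ≤ m := by
          rw [Finset.sum_const, nsmul_one, Nat.cast_le, ← Nat.map_div_right_divisors, Finset.card_map]
          exact Nat.card_divisors_le_self m
  exact_mod_cast h

open ArithmeticFunction in
theorem stmt5 (k : ℕ) (hk : 5 ≤ k) (α : ℝ) (hα₁ : 2 / (k : ℝ) < α) (hα₂ : α < 1)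
    (Q : Polynomial ℝ) (hQ : Q.natDegree = k - 1)
    (hasymp : ∀ ε : ℝ, 0 < ε → ∃ C : ℝ, 0 < C ∧ ∀ x : ℝ, 5 < x →
      |(∑ n ∈ Finset.Icc 1 ⌊x⌋₊, (piltzTau k n : ℝ)) - x * Q.eval (Real.log x)|
        ≤ C * x ^ (α + ε)) :
    ∃ P : Polynomial ℝ, P.natDegree = k - 1 ∧
      ∀ ε : ℝ, 0 < ε → ∃ C : ℝ, 0 < C ∧ ∀ x : ℝ, 5 < x →
        |Sgk (fun n => ((moebius n : ℤ) : ℝ)) k x - x * P.eval (Real.log x)|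
          ≤ C * x ^ (α + ε) := by
  set h : ℕ → ℝ := fun m => (((moebius * moebius) m : ℤ) : ℝ) with hh
  have hle : ∀ m, |h m| ≤ m := abs_moebius_mul_moebius_le
  have h0 : h 0 = 0 := by simp [hh]
  have h1 : h 1 = 1 := by simp [hh, mul_apply]
  have hk0 : (0 : ℝ) < k := by positivity
  obtain ⟨P, hP, hPsum⟩ := exists_polynomial_hasSum hle h1 hk hQ
  refine ⟨P, hP, fun ε hε => ?_⟩
  have hα0 : 0 < α := lt_trans (by positivity) hα₁
  set β : ℝ := α + min ε ((1 - α) / 2) with hβdef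
  have hαβ : α ≤ β := le_add_of_nonneg_right (le_min hε.le (by linarith))
  have hβ1 : β < 1 := by
    have := min_le_right ε ((1 - α) / 2)
    linarith
  obtain ⟨C, hC, hCx⟩ := exists_error_bound_of_pos (fun n => (piltzTau k n : ℝ)) Q
    (hα0.le.trans hαβ) hβ1 (hasymp _ (lt_min hε (by linarith)))
  have hkβ : 1 < k * β - 1 := by
    rw [div_lt_iff₀ hk0] at hα₁
    nlinarith
  have hD : Summable fun m : ℕ => 1 / (m : ℝ) ^ (k * β - 1) :=
    Real.summable_one_div_nat_rpow.2 hkβ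
  have hD0 : 0 ≤ ∑' m : ℕ, 1 / (m : ℝ) ^ (k * β - 1) := tsum_nonneg fun m => by positivity
  refine ⟨C * (∑' m : ℕ, 1 / (m : ℝ) ^ (k * β - 1)) + 1, by positivity, fun x hx => ?_⟩
  have hx0 : 0 < x := by linarith
  have hS := (hasSum_Sgk (g := fun n => ((moebius n : ℤ) : ℝ)) (h := h)
    (fun e _ => moebius_eq_sum_moebius_mul_moebius e) h0 (by omega : k ≠ 0) x).sub
      ((hPsum (Real.log x)).mul_left x)
  have hbd := tsum_of_norm_bounded (hD.hasSum.mul_left (C * x ^ β)) (f := _) (a := _) (fun m => by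
    show ‖h m * (∑ n ∈ Finset.Icc 1 ⌊x / (m : ℝ) ^ k⌋₊, (piltzTau k n : ℝ)) -
      x * (h m / (m : ℝ) ^ k * Q.eval (Real.log x - k * Real.log m))‖ ≤ _
    rcases Nat.eq_zero_or_pos m with rfl | hm
    · simp only [h0, zero_mul, zero_div, mul_zero, sub_zero, norm_zero]
      positivity
    have hm0 : (0 : ℝ) < m := by exact_mod_cast hm
    have hlog : Real.log x - k * Real.log m = Real.log (x / (m : ℝ) ^ k) := by
      rw [Real.log_div hx0.ne' (by positivity), Real.log_pow]
    have hpow : (x / (m : ℝ) ^ k) ^ β = x ^ β / (m : ℝ) ^ (k * β) := by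
      rw [Real.div_rpow hx0.le (by positivity), ← Real.rpow_natCast, ← Real.rpow_mul hm0.le]
    have hb := hCx (x / (m : ℝ) ^ k) (by positivity)
    rw [hpow] at hb
    rw [hlog, Real.norm_eq_abs]
    calc _ = |h m| * |(∑ n ∈ Finset.Icc 1 ⌊x / (m : ℝ) ^ k⌋₊, (piltzTau k n : ℝ)) -
          x / (m : ℝ) ^ k * Q.eval (Real.log (x / (m : ℝ) ^ k))| := by
          rw [← abs_mul]
          congr 1
          ring
      _ ≤ m * (C * (x ^ β / (m : ℝ) ^ (k * β))) := by gcongr; exact hle m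
      _ = C * x ^ β * (1 / (m : ℝ) ^ (k * β - 1)) := by
          rw [Real.rpow_sub_one hm0.ne']
          field_simp)
  rw [hS.tsum_eq, Real.norm_eq_abs] at hbd
  have hxβ : x ^ β ≤ x ^ (α + ε) :=
    Real.rpow_le_rpow_of_exponent_le (by linarith) (by
      have := min_le_left ε ((1 - α) / 2)
      linarith)
  have hxβ0 : 0 < x ^ β := Real.rpow_pos_of_pos hx0 β
  calc _ ≤ C * x ^ β * ∑' m : ℕ, 1 / (m : ℝ) ^ (k * β - 1) := hbd
    _ ≤ (C * (∑' m : ℕ, 1 / (m : ℝ) ^ (k * β - 1)) + 1) * x ^ β := by linarith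
    _ ≤ _ := by gcongr
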